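/- arXiv:2308.11230 — 3 statements merged into one kernel-verified Lean document; each statement's English description precedes it below -/
import Mathlib

section
/- Let w ∈ ℝ^{[n]×[n]} be any weight matrix. For each i∈[n] set β̃_i = max_{j∈[n]} (w_{i,j} − w_{i,i}), and let β_1 ≥ β_2 ≥ … ≥ β_n be the values (β̃_1,…,β̃_n) arranged in descending order. Let σ be a maximum weight permutation for w and let p* be the minimum subsidy vector for w with respect to σ. Then for every r∈[n], the r-th largest entry among p*_1,…,p*_n is at most Σ_{ℓ=1}^{n−r} β_ℓ. -/
/-- `p` lies in the polyhedron `P^σ` of envy-eliminating subsidy vectors for weight matrix `w`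
with respect to permutation `σ`. -/
def inP {n : ℕ} (w : Fin n → Fin n → ℝ) (σ : Equiv.Perm (Fin n)) (p : Fin n → ℝ) : Prop :=
  (∀ i, 0 ≤ p i) ∧ ∀ i j, w i j + p j ≤ w i (σ i) + p (σ i)

/-- `σ` is a maximum weight permutation for `w`. -/
def maxWeightPerm {n : ℕ} (w : Fin n → Fin n → ℝ) (σ : Equiv.Perm (Fin n)) : Prop :=
  ∀ τ : Equiv.Perm (Fin n), ∑ i, w i (τ i) ≤ ∑ i, w i (σ i)

/-- `p` is the minimum subsidy vector for `w` with respect to `σ`: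
the unique minimal element of `P^σ`. -/
def minSubsidyVec {n : ℕ} (w : Fin n → Fin n → ℝ) (σ : Equiv.Perm (Fin n))
    (p : Fin n → ℝ) : Prop :=
  inP w σ p ∧ ∀ p', inP w σ p' → ∀ i, p i ≤ p' i

/-- `A` is an ordered partition of the whole set of items. -/
def isPartition {n : ℕ} {M : Type*} [DecidableEq M] [Fintype M]
    (A : Fin n → Finset M) : Prop :=
  (∀ i j, i ≠ j → Disjoint (A i) (A j)) ∧ Finset.univ.biUnion A = Finset.univ

/-- The allocation `A` is envy-free up to `k` items for valuations `v`. -/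
def EFk {n : ℕ} {M : Type*} [DecidableEq M] (v : Fin n → Finset M → ℝ)
    (A : Fin n → Finset M) (k : ℕ) : Prop :=
  ∀ i j, ∃ X ⊆ A i ∪ A j, X.card ≤ k ∧ v i (A j \ X) ≤ v i (A i \ X)

/-- The allocation with subsidy `(A, p)` is envy-free. -/
def envyFree {n : ℕ} {M : Type*} (v : Fin n → Finset M → ℝ)
    (A : Fin n → Finset M) (p : Fin n → ℝ) : Prop :=
  ∀ i j, v i (A j) + p j ≤ v i (A i) + p i

/-- An antitone nonnegative family sums over any `m` indices to at most its sum over the first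
`m` indices. -/
lemma sum_le_sum_initial {n m : ℕ} (g : Fin n → ℝ) (hg : Antitone g) (h0 : ∀ i, 0 ≤ g i)
    (hm : m ≤ n) (S : Finset (Fin n)) (hS : S.card ≤ m) :
    ∑ i ∈ S, g i ≤ ∑ i ∈ Finset.univ.filter (fun i : Fin n => (i : ℕ) < m), g i := by
  set F := Finset.univ.filter (fun i : Fin n => (i : ℕ) < m) with hF
  have hcard : F.card = m := by
    rw [hF, Fin.card_filter_val_lt, min_eq_right hm]
  rcases hm.eq_or_lt with rfl | hlt
  · exact Finset.sum_le_sum_of_subset_of_nonneg (fun i _ => by simp [hF]) fun i _ _ => h0 i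
  · have hdiff : (S \ F).card ≤ (F \ S).card := by
      have h1 := Finset.card_sdiff_add_card_inter S F
      have h2 := Finset.card_sdiff_add_card_inter F S
      rw [Finset.inter_comm] at h2
      omega
    have hupper : ∑ i ∈ S \ F, g i ≤ (S \ F).card • g ⟨m, hlt⟩ := by
      refine Finset.sum_le_card_nsmul _ _ _ fun i hi => hg ?_
      have hi' : ¬ (i : ℕ) < m := by simpa [hF] using (Finset.mem_sdiff.mp hi).2
      exact Fin.le_def.mpr (not_lt.mp hi')
    have hlower : (F \ S).card • g ⟨m, hlt⟩ ≤ ∑ i ∈ F \ S, g i := by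
      refine Finset.card_nsmul_le_sum _ _ _ fun i hi => hg ?_
      have hi' : (i : ℕ) < m := by simpa [hF] using (Finset.mem_sdiff.mp hi).1
      exact Fin.le_def.mpr hi'.le
    have hmid := nsmul_le_nsmul_left (h0 ⟨m, hlt⟩) hdiff
    have hSsum := Finset.sum_inter_add_sum_sdiff S F g
    have hFsum := Finset.sum_inter_add_sum_sdiff F S g
    rw [Finset.inter_comm] at hFsum
    linarith

/-- If a coordinate of the minimum subsidy vector is positive, then some agent whose index has
at least that subsidy is indifferent between its own item and one with smaller subsidy. -/
lemma minSubsidyVec.exists_tight {n : ℕ} {w : Fin n → Fin n → ℝ} {σ : Equiv.Perm (Fin n)}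
    {p : Fin n → ℝ} (hp : minSubsidyVec w σ p) (a : Fin n) (ha : 0 < p a) :
    ∃ i j, p a ≤ p i ∧ p j < p a ∧ w i j + p j = w i (σ i) + p (σ i) := by
  by_contra! hcon
  have hmaps : ∀ i, p a ≤ p i → p a ≤ p (σ i) := by
    intro i hi
    by_contra! hlt
    exact hcon i (σ i) hi hlt rfl
  have hback : ∀ i, p a ≤ p (σ i) → p a ≤ p i := by
    intro i hi
    have himage : (Finset.univ.filter (fun i => p a ≤ p i)).image σ
        = Finset.univ.filter (fun i => p a ≤ p i) := by
      refine Finset.eq_of_subset_of_card_le ?_ ?_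
      · intro x hx
        obtain ⟨y, hy, rfl⟩ := Finset.mem_image.mp hx
        simpa using hmaps y (by simpa using hy)
      · rw [Finset.card_image_of_injective _ σ.injective]
    have hmem : σ i ∈ (Finset.univ.filter (fun i => p a ≤ p i)).image σ := by
      rw [himage]; simpa using hi
    obtain ⟨y, hy, hyi⟩ := Finset.mem_image.mp hmem
    rw [← σ.injective hyi]
    simpa using hy
  obtain ⟨ε, ⟨hεa, hε⟩, hεpos⟩ : ∃ ε : ℝ, (ε ≤ p a ∧ ∀ i j, p a ≤ p i → p j < p a →
      ε ≤ w i (σ i) + p (σ i) - (w i j + p j)) ∧ 0 < ε := by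
    have hsmall : ∀ c : ℝ, 0 < c → ∀ᶠ ε in nhdsWithin (0 : ℝ) (Set.Ioi 0), ε ≤ c :=
      fun c hc => nhdsWithin_le_nhds (eventually_le_nhds hc)
    refine (((hsmall _ ha).and (Filter.eventually_all.mpr fun i =>
      Filter.eventually_all.mpr fun j => ?_)).and self_mem_nhdsWithin).exists
    by_cases hij : p a ≤ p i ∧ p j < p a
    · have hne := hcon i j hij.1 hij.2
      filter_upwards [hsmall _ (sub_pos.mpr ((hp.1.2 i j).lt_of_ne hne))] with ε h _ _ using h
    · exact Filter.Eventually.of_forall fun ε h1 h2 => (hij ⟨h1, h2⟩).elim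
  have hle := hp.2 (fun i => if p a ≤ p i then p i - ε else p i) ⟨fun i => ?_, fun i j => ?_⟩ a
  · simp only [le_refl, if_true] at hle
    linarith
  · have := hp.1.1 i
    dsimp only
    split_ifs <;> linarith
  · have hij := hp.1.2 i j
    dsimp only
    split_ifs with h1 h2 h2
    · linarith
    · linarith
    · linarith [hε i j (hback i h2) (not_le.mp h1)]
    · exact hij

/-- A coordinate of the minimum subsidy vector is bounded by the sum of `β` over a set of at most
as many agents as there are strictly smaller coordinates. -/
lemma minSubsidyVec.exists_card_le_sum {n : ℕ} {w : Fin n → Fin n → ℝ}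
    {σ : Equiv.Perm (Fin n)} {p : Fin n → ℝ} (hp : minSubsidyVec w σ p) {β : Fin n → ℝ}
    (hβ : ∀ i j, w i j - w i i ≤ β i) (a : Fin n) :
    ∃ S : Finset (Fin n), S.card ≤ (Finset.univ.filter (fun j => p j < p a)).card ∧
      p a ≤ ∑ i ∈ S, β i := by
  have hmin : ∀ i, ∃ t, w i t + p t = w i (σ i) + p (σ i) ∧
      ∀ j, w i j + p j = w i (σ i) + p (σ i) → p t ≤ p j := by
    intro i
    obtain ⟨t, ht, htmin⟩ := Finset.exists_min_image
      (Finset.univ.filter fun j => w i j + p j = w i (σ i) + p (σ i)) p ⟨σ i, by simp⟩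
    exact ⟨t, by simpa using ht, fun j hj => htmin j (by simpa using hj)⟩
  choose t ht htmin using hmin
  suffices ∀ a, ∃ S : Finset (Fin n),
      S.card ≤ (Finset.univ.filter (fun j => p j < p a)).card ∧
      p a ≤ ∑ i ∈ S, β i ∧ ∀ x ∈ S, p (t x) < p a by
    obtain ⟨S, h1, h2, _⟩ := this a
    exact ⟨S, h1, h2⟩
  intro a
  induction hk : (Finset.univ.filter (fun j => p j < p a)).card using Nat.strong_induction_on
    generalizing a with
  | _ k ih =>
    rcases (hp.1.1 a).eq_or_lt with h0 | hpos
    · exact ⟨∅, by simp, by simp [← h0], by simp⟩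
    obtain ⟨i, j, hai, hja, hij⟩ := hp.exists_tight a hpos
    have hta : p (t i) < p a := (htmin i j hij).trans_lt hja
    have hlt : (Finset.univ.filter (fun j => p j < p (t i))).card < k := by
      rw [← hk]
      refine Finset.card_lt_card (Finset.ssubset_iff_of_subset ?_ |>.mpr ⟨t i, ?_, ?_⟩)
      · intro x hx
        simp only [Finset.mem_filter, Finset.mem_univ, true_and] at hx ⊢
        exact hx.trans hta
      · simpa using hta
      · simp
    obtain ⟨S, hcard, hsum, hS⟩ := ih _ hlt (t i) rfl
    have hiS : i ∉ S := fun hi => (hS i hi).false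
    refine ⟨insert i S, ?_, ?_, ?_⟩
    · rw [Finset.card_insert_of_notMem hiS]
      omega
    · rw [Finset.sum_insert hiS]
      linarith [hβ i (t i), ht i, hp.1.2 i i]
    · intro x hx
      rcases Finset.mem_insert.mp hx with rfl | hx
      · exact hta
      · exact (hS x hx).trans hta

theorem rth_largest_min_subsidy_bound {n : ℕ} (hn : 1 ≤ n)
    (w : Fin n → Fin n → ℝ)
    (σ : Equiv.Perm (Fin n)) (hσ : maxWeightPerm w σ)
    (p : Fin n → ℝ) (hp : minSubsidyVec w σ p)
    (β : Fin n → ℝ)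
    (hβ : ∀ i, β i =
      Finset.univ.sup' ⟨⟨0, hn⟩, Finset.mem_univ _⟩ (fun j => w i j - w i i))
    -- `τp` enumerates the entries of `p` in descending order
    (τp : Equiv.Perm (Fin n)) (hτp : ∀ a b : Fin n, a ≤ b → p (τp b) ≤ p (τp a))
    -- `τβ` enumerates the values `β` in descending order
    (τβ : Equiv.Perm (Fin n)) (hτβ : ∀ a b : Fin n, a ≤ b → β (τβ b) ≤ β (τβ a)) :
    -- the `r`-th largest entry of `p` (0-indexed) is at most the sum of the
    -- `n - 1 - r` largest values of `β`
    ∀ r : Fin n, p (τp r) ≤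
      ∑ ℓ ∈ Finset.univ.filter (fun ℓ : Fin n => (ℓ : ℕ) < n - 1 - (r : ℕ)), β (τβ ℓ) := by
  intro r
  have hle : ∀ i j, w i j - w i i ≤ β i := fun i j => by
    rw [hβ i]
    exact Finset.le_sup' (fun j => w i j - w i i) (Finset.mem_univ j)
  obtain ⟨S, hcard, hsum⟩ := hp.exists_card_le_sum hle (τp r)
  have hsmaller : (Finset.univ.filter (fun j => p j < p (τp r))).card ≤ n - 1 - (r : ℕ) := by
    rw [← Fin.card_Ioi r, ← Finset.card_map (s := Finset.Ioi r) τp.toEmbedding]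
    refine Finset.card_le_card fun j hj => ?_
    have hj := (Finset.mem_filter.mp hj).2
    refine Finset.mem_map.mpr ⟨τp.symm j, Finset.mem_Ioi.mpr ?_, by simp⟩
    by_contra! h
    have := hτp _ _ h
    rw [Equiv.apply_symm_apply] at this
    linarith
  refine hsum.trans ?_
  have hreindex : ∑ i ∈ S, β i = ∑ ℓ ∈ S.map τβ.symm.toEmbedding, β (τβ ℓ) := by
    simp [Finset.sum_map]
  rw [hreindex]
  exact sum_le_sum_initial (fun ℓ => β (τβ ℓ)) (fun a b hab => hτβ a b hab)
    (fun ℓ => by simpa using hle (τβ ℓ) (τβ ℓ)) (by omega) _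
    (by rw [Finset.card_map]; exact hcard.trans hsmaller)
end

section
/- Assume n ≥ 3 and all valuations are monotone with marginal bound 1. Let A be an EF1 allocation such that Σ_i v_i(A_i) ≥ Σ_i v_i(A_{σ(i)}) for every permutation σ for which (A_{σ(1)},…,A_{σ(n)}) is EF1. Let w_{i,j}=v_i(A_j), p* the minimum subsidy vector for w, q_i = max_j(w_{i,j}+p*_j), r_i = q_i−(w_{i,i}+p*_i), and s_k = 1 + r_k + v_k(A_k) − v_k(A_{k−1}) for k=2,…,n. Assume the path (n,n−1,…,1) is a maximum-weight simple path in the envy graph G^{ŵ,id} (where ŵ_{i,i}=v_i(A_i)+r_i, ŵ_{i,j}=v_i(A_j) for i≠j), and that its weight Σ_{i=2}^n (1−s_i) > n − 1.5 (so Σ_{i=2}^n s_i < 0.5 and 0 ≤ r_i ≤ s_i ≤ 1). Then for every j ∈ {2,…,n}: v_1(A_j) ≤ max{ v_1(A_1) − (1 − s_2), min_{e∈A_1} v_1(A_1∖{e}) }. -/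
/-- The weight of the (simple) path visiting the vertices of the list `l` in order,
in the envy graph `G^{wh, id}` whose edge `(i, j)` has weight `wh i j - wh i i`. -/
def pathWeight {n : ℕ} (wh : Fin n → Fin n → ℝ) (l : List (Fin n)) : ℝ :=
  ((l.zip l.tail).map (fun ab => wh ab.1 ab.2 - wh ab.1 ab.1)).sum

theorem le_sdiff_add_one {M : Type*} [DecidableEq M] {u : Finset M → ℝ}
    (hmb : ∀ (e : M) (X : Finset M), e ∉ X → |u (insert e X) - u X| ≤ 1)
    (B : Finset M) {X : Finset M} (hX : X.card ≤ 1) : u B ≤ u (B \ X) + 1 := by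
  rcases Nat.le_one_iff_eq_zero_or_eq_one.mp hX with h | h
  · rw [Finset.card_eq_zero.mp h, Finset.sdiff_empty]
    linarith
  · obtain ⟨e, rfl⟩ := Finset.card_eq_one.mp h
    rw [Finset.sdiff_singleton_eq_erase]
    by_cases he : e ∈ B
    · have := hmb e (B.erase e) (Finset.notMem_erase e B)
      rw [Finset.insert_erase he] at this
      linarith [le_of_abs_le this]
    · rw [Finset.erase_eq_of_notMem he]
      linarith

/-- In an EF1 allocation no agent envies another one by more than the marginal bound. -/
theorem EFk.le_add_one {n : ℕ} {M : Type*} [DecidableEq M] {v : Fin n → Finset M → ℝ}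
    (hmono : ∀ (i : Fin n) (X Y : Finset M), X ⊆ Y → v i X ≤ v i Y)
    (hmb : ∀ (i : Fin n) (e : M) (X : Finset M), e ∉ X → |v i (insert e X) - v i X| ≤ 1)
    {A : Fin n → Finset M} (hA : EFk v A 1) (i j : Fin n) :
    v i (A j) ≤ v i (A i) + 1 := by
  obtain ⟨X, -, hX, h⟩ := hA i j
  linarith [le_sdiff_add_one (hmb i) (A j) hX, hmono i (A i \ X) (A i) Finset.sdiff_subset]

/-- An agent who is envy-free up to one item towards the bundle `C` when holding `B` remains so
when holding a bundle that is worth at least as much as `B`. -/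
theorem exists_sdiff_le_of_le {M : Type*} [DecidableEq M] {u : Finset M → ℝ}
    (hmono : ∀ X Y : Finset M, X ⊆ Y → u X ≤ u Y) {B B' C : Finset M}
    (h : ∃ X ⊆ B ∪ C, X.card ≤ 1 ∧ u (C \ X) ≤ u (B \ X))
    (hB' : Disjoint B' C) (hle : u B ≤ u B') :
    ∃ X ⊆ B' ∪ C, X.card ≤ 1 ∧ u (C \ X) ≤ u (B' \ X) := by
  obtain ⟨X, -, hX, h⟩ := h
  refine ⟨X ∩ C, Finset.inter_subset_right.trans Finset.subset_union_right,
    (Finset.card_le_card Finset.inter_subset_left).trans hX, ?_⟩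
  have hB'X : B' \ (X ∩ C) = B' :=
    Finset.sdiff_eq_self_of_disjoint (hB'.mono_right Finset.inter_subset_right)
  have hCX : C \ (X ∩ C) = C \ X := by
    ext x; simp only [Finset.mem_sdiff, Finset.mem_inter]; tauto
  rw [hB'X, hCX]
  exact h.trans ((hmono _ _ Finset.sdiff_subset).trans hle)

/-- Permuting the bundles of an EF1 allocation preserves EF1 if every agent other than `a` weakly
gains, and `a` receives a bundle `B` that is worth at least every bundle except possibly her
original one, from which it suffices to remove one item. -/
theorem EFk.perm {n : ℕ} {M : Type*} [DecidableEq M] {v : Fin n → Finset M → ℝ}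
    (hmono : ∀ (i : Fin n) (X Y : Finset M), X ⊆ Y → v i X ≤ v i Y)
    {A : Fin n → Finset M} (hdisj : ∀ i j, i ≠ j → Disjoint (A i) (A j)) (hA : EFk v A 1)
    (τ : Equiv.Perm (Fin n)) (a : Fin n) (hgain : ∀ i, i ≠ a → v i (A i) ≤ v i (A (τ i)))
    (hbest : ∀ j, j ≠ a → v a (A j) ≤ v a (A (τ a)))
    {e : M} (he : e ∈ A a) (hea : v a ((A a).erase e) ≤ v a (A (τ a))) (hτa : τ a ≠ a) :
    EFk v (fun i => A (τ i)) 1 := by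
  intro i l
  dsimp only
  have of_le : v i (A (τ l)) ≤ v i (A (τ i)) →
      ∃ X ⊆ A (τ i) ∪ A (τ l), X.card ≤ 1 ∧ v i (A (τ l) \ X) ≤ v i (A (τ i) \ X) :=
    fun h => ⟨∅, by simp, by simp, by simpa using h⟩
  rcases eq_or_ne i a with rfl | hi
  · rcases eq_or_ne (τ l) i with hl | hl
    · refine ⟨{e}, by simp [hl, he], by simp, ?_⟩
      have : A (τ i) \ {e} = A (τ i) := Finset.sdiff_eq_self_of_disjoint
        ((hdisj _ _ hτa).mono_right (Finset.singleton_subset_iff.mpr he))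
      rw [this, hl, Finset.sdiff_singleton_eq_erase]
      exact hea
    · exact of_le (hbest _ hl)
  · rcases eq_or_ne (τ l) i with hl | hl
    · exact of_le (hl ▸ hgain i hi)
    rcases eq_or_ne (τ i) (τ l) with hil | hil
    · exact of_le (by rw [hil])
    · exact exists_sdiff_le_of_le (hmono i) (hA i (τ l)) (hdisj _ _ hil) (hgain i hi)

theorem v1_bundle_upper_bound {n : ℕ} (hn : 3 ≤ n)
    {M : Type*} [DecidableEq M] [Fintype M]
    (v : Fin n → Finset M → ℝ)
    (hmono : ∀ (i : Fin n) (X Y : Finset M), X ⊆ Y → v i X ≤ v i Y)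
    (hmb : ∀ (i : Fin n) (e : M) (X : Finset M), e ∉ X → |v i (insert e X) - v i X| ≤ 1)
    (A : Fin n → Finset M) (hpart : isPartition A)
    (hEF1 : EFk v A 1)
    -- `A` maximizes the utilitarian welfare among EF1 permutations of its bundles
    (hopt : ∀ σ : Equiv.Perm (Fin n),
      EFk v (fun i => A (σ i)) 1 → ∑ i, v i (A (σ i)) ≤ ∑ i, v i (A i))
    (w : Fin n → Fin n → ℝ) (hw : ∀ i j, w i j = v i (A j))
    (σ : Equiv.Perm (Fin n)) (hσ : maxWeightPerm w σ)
    (p : Fin n → ℝ) (hp : minSubsidyVec w σ p)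
    (q : Fin n → ℝ) (hq : ∀ i, IsGreatest (Set.range fun j => w i j + p j) (q i))
    (r : Fin n → ℝ) (hr : ∀ i, r i = q i - (w i i + p i))
    (wh : Fin n → Fin n → ℝ)
    (hwh : ∀ i j, wh i j = if i = j then v i (A i) + r i else v i (A j))
    (s : Fin n → ℝ)
    (hs : ∀ k : Fin n, k ≠ ⟨0, by omega⟩ →
      s k = 1 + r k + v k (A k)
        - v k (A ⟨(k : ℕ) - 1, Nat.lt_of_le_of_lt (Nat.sub_le _ _) k.isLt⟩))
    -- the path (n, n-1, ..., 1) is a maximum-weight simple path in `G^{wh, id}`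
    (hpathmax : ∀ l : List (Fin n), l.Nodup →
      pathWeight wh l ≤ pathWeight wh (List.finRange n).reverse)
    -- and its weight `∑_{i=2}^n (1 - s_i)` exceeds `n - 1.5`
    (hweight : (n : ℝ) - 1.5 <
      ∑ k ∈ Finset.univ.filter (fun k : Fin n => k ≠ ⟨0, by omega⟩), (1 - s k)) :
    ∀ j : Fin n, j ≠ ⟨0, by omega⟩ →
      (v ⟨0, by omega⟩ (A j) ≤
          v ⟨0, by omega⟩ (A ⟨0, by omega⟩) - (1 - s ⟨1, by omega⟩) ∨
        ∀ e ∈ A ⟨0, by omega⟩,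
          v ⟨0, by omega⟩ (A j) ≤ v ⟨0, by omega⟩ ((A ⟨0, by omega⟩).erase e)) := by
  obtain ⟨m, rfl⟩ : ∃ m, n = m + 2 := ⟨n - 2, by omega⟩
  have hzero : (⟨0, by omega⟩ : Fin (m + 2)) = 0 := rfl
  have hone : (⟨1, by omega⟩ : Fin (m + 2)) = (0 : Fin (m + 1)).succ := rfl
  simp only [hzero, hone] at hs hweight ⊢
  have hr0 (i) : 0 ≤ r i := by
    rw [hr]
    linarith [(hq i).2 ⟨i, rfl⟩]
  have hs' (k : Fin (m + 1)) :
      s k.succ = 1 + r k.succ + v k.succ (A k.succ) - v k.succ (A k.castSucc) :=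
    hs k.succ (Fin.succ_ne_zero k)
  have hs0 (k : Fin (m + 1)) : 0 ≤ s k.succ := by
    linarith [hs' k, hr0 k.succ, hEF1.le_add_one hmono hmb k.succ k.castSucc]
  have hsum : ∑ k : Fin (m + 1), s k.succ < 1 / 2 := by
    rw [Finset.sum_filter, Fin.sum_univ_succ] at hweight
    simp only [ne_eq, not_true_eq_false, if_false, Fin.succ_ne_zero, not_false_eq_true, if_true,
      Finset.sum_sub_distrib, Finset.sum_const, Finset.card_univ, Fintype.card_fin,
      nsmul_eq_mul] at hweight
    push_cast at hweight
    linarith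
  have hs1 (k : Fin (m + 1)) : s k.succ < 1 / 2 :=
    (Finset.single_le_sum (f := fun k : Fin (m + 1) => s k.succ) (fun k _ => hs0 k)
      (Finset.mem_univ k)).trans_lt hsum
  obtain ⟨b, hb⟩ := Finite.exists_max fun k : Fin (m + 1) => v 0 (A k.succ)
  have hbest : ∀ j, j ≠ 0 → v 0 (A j) ≤ v 0 (A b.succ) := by
    intro j hj
    obtain ⟨k, rfl⟩ := Fin.exists_succ_eq.mpr hj
    exact hb k
  suffices hmain : v 0 (A b.succ) ≤ v 0 (A 0) - (1 - s (Fin.succ 0)) ∨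
      ∀ e ∈ A 0, v 0 (A b.succ) ≤ v 0 ((A 0).erase e) from
    fun j hj => hmain.imp (hbest j hj).trans fun h e he => (hbest j hj).trans (h e he)
  by_contra! hcon
  obtain ⟨hlarge, e, he, hlt⟩ := hcon
  set τ : Equiv.Perm (Fin (m + 2)) := b.succ.cycleRange.symm
  have hτ0 : τ 0 = b.succ := Fin.cycleRange_symm_zero _
  have hτs (k : Fin (m + 1)) : τ k.succ = b.succ.succAbove k := Fin.cycleRange_symm_succ _ _
  have hgain (k : Fin (m + 1)) : v k.succ (A k.succ) ≤ v k.succ (A (τ k.succ)) := by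
    rw [hτs]
    rcases lt_or_ge k.castSucc b.succ with h | h
    · rw [Fin.succAbove_of_castSucc_lt _ _ h]
      linarith [hs' k, hr0 k.succ, hs1 k]
    · rw [Fin.succAbove_of_le_castSucc _ _ h]
  have hEF : EFk v (fun i => A (τ i)) 1 := by
    refine hEF1.perm hmono hpart.1 τ 0 ?_ (by rwa [hτ0]) he (by rw [hτ0]; exact hlt.le)
      (by rw [hτ0]; exact Fin.succ_ne_zero b)
    intro i hi
    obtain ⟨k, rfl⟩ := Fin.exists_succ_eq.mpr hi
    exact hgain k
  have hle := hopt τ hEF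
  rw [Fin.sum_univ_succ, Fin.sum_univ_succ (fun i => v i (A i)), hτ0] at hle
  have hfirst := Finset.single_le_sum
    (f := fun k : Fin (m + 1) => v k.succ (A (τ k.succ)) - v k.succ (A k.succ))
    (fun k _ => sub_nonneg.mpr (hgain k)) (Finset.mem_univ 0)
  rw [Finset.sum_sub_distrib] at hfirst
  have hτ1 : τ (Fin.succ 0) = Fin.castSucc 0 := by
    rw [hτs]
    exact Fin.succAbove_of_castSucc_lt _ _ (Fin.succ_pos b)
  rw [hτ1] at hfirst
  linarith [hs' 0, hr0 (Fin.succ 0)]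
end

section
/- In the instance of the previous example (n ≥ 2 agents, items e_{i,j} for i∈[n], j∈[n+1], additive valuations v_i({e_{i',j}}) = n/(n+1) if i'=i, 1 if i'=i−1, 0 otherwise, A_i = {e_{i,1},…,e_{i,n+1}}), let e* = e_{1,1} and A' = (A_1∖{e*}, A_2, A_3, …, A_{n−1}, A_n∪{e*}). Then the minimum subsidy vector for the weight matrix w' = (v_i(A'_j))_{i,j∈[n]} is (0, 0, 1, 2, …, n−2); in particular its maximum entry is n−2 and its total is (n−1)(n−2)/2. -/
theorem maxWeightPerm_of_inP {n : ℕ} {w : Fin n → Fin n → ℝ} {σ : Equiv.Perm (Fin n)}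
    {p : Fin n → ℝ} (h : inP w σ p) : maxWeightPerm w σ := by
  intro τ
  have hsum : ∑ i, (w i (τ i) + p (τ i)) ≤ ∑ i, (w i (σ i) + p (σ i)) :=
    Finset.sum_le_sum fun i _ => h.2 i (τ i)
  rw [Finset.sum_add_distrib, Finset.sum_add_distrib, Equiv.sum_comp τ p,
    Equiv.sum_comp σ p] at hsum
  linarith

theorem sum_filter_fst_eq {n : ℕ} (g : Fin n → ℝ) (j : Fin n) :
    ∑ e ∈ (Finset.univ : Finset (Fin n × Fin (n + 1))).filter (fun e => e.1 = j), g e.1 =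
      (n + 1) * g j := by
  rw [Finset.sum_filter, Fintype.sum_prod_type]
  simp

/-- The weight matrix `(v_i(A'_j))`, with agents numbered from `0`. -/
noncomputable def modifiedWeight (n i j : ℕ) : ℝ :=
  (if j = i then (n : ℝ) else if j + 1 = i then (n : ℝ) + 1 else 0) +
    (if j = 0 then -1 else if j = n - 1 then 1 else 0) *
      (if i = 0 then (n : ℝ) / (n + 1) else if i = 1 then 1 else 0)

theorem modifiedWeight_add_le {n i j : ℕ} (hn : 2 ≤ n) (hi : i < n) (hj : j < n) :
    modifiedWeight n i j + ((j - 1 : ℕ) : ℝ) ≤ modifiedWeight n i i + ((i - 1 : ℕ) : ℝ) := by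
  have hn' : (2 : ℝ) ≤ n := by exact_mod_cast hn
  have hq : (n : ℝ) / (n + 1) ≤ 1 := (div_le_one (by positivity)).2 (by linarith)
  have hq0 : (0 : ℝ) ≤ (n : ℝ) / (n + 1) := by positivity
  have hjn : ((j - 1 : ℕ) : ℝ) ≤ n - 2 := by
    have : j - 1 + 2 ≤ n := by omega
    have : ((j - 1 : ℕ) : ℝ) + 2 ≤ n := by exact_mod_cast this
    linarith
  have hi0 : (0 : ℝ) ≤ ((i - 1 : ℕ) : ℝ) := Nat.cast_nonneg _
  rcases eq_or_ne j i with rfl | hji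
  · exact le_rfl
  unfold modifiedWeight
  by_cases hpred : j + 1 = i
  · subst hpred
    rcases Nat.eq_zero_or_pos j with rfl | hj0
    · simp only [Nat.zero_add, one_ne_zero, zero_ne_one, if_true, if_false]
      norm_num
      split_ifs <;> norm_num
    · have hcast : ((j - 1 : ℕ) : ℝ) = (j : ℝ) - 1 := by
        rw [Nat.cast_sub hj0, Nat.cast_one]
      have hlast : j ≠ n - 1 := by omega
      simp [hj0.ne', hlast, hcast]
  · simp only [hji, hpred, if_false, if_true]
    split_ifs <;> first | omega | linarith

theorem inP_modifiedWeight {n : ℕ} (hn : 2 ≤ n) :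
    inP (fun i j : Fin n => modifiedWeight n i j) 1 (fun i => (((i : ℕ) - 1 : ℕ) : ℝ)) :=
  ⟨fun _ => Nat.cast_nonneg _, fun i j => modifiedWeight_add_le hn i.2 j.2⟩

theorem le_of_inP_modifiedWeight {n : ℕ} {p : Fin n → ℝ}
    (hp : inP (fun i j : Fin n => modifiedWeight n i j) 1 p) (k : ℕ) (hk : k < n) :
    ((k - 1 : ℕ) : ℝ) ≤ p ⟨k, hk⟩ := by
  induction k with
  | zero => simpa using hp.1 ⟨0, hk⟩
  | succ k ih =>
    rcases Nat.eq_zero_or_pos k with rfl | hk0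
    · simpa using hp.1 ⟨1, hk⟩
    · have hprev := ih (by omega)
      have hstep := hp.2 ⟨k + 1, hk⟩ ⟨k, by omega⟩
      have hlast : k ≠ n - 1 := by omega
      simp [modifiedWeight, hk0.ne', hlast] at hstep
      rw [Nat.cast_sub hk0, Nat.cast_one] at hprev
      rw [Nat.add_sub_cancel]
      linarith

theorem sum_range_sub_one (m : ℕ) :
    ∑ i ∈ Finset.range (m + 1), ((i - 1 : ℕ) : ℝ) = (m : ℝ) * ((m : ℝ) - 1) / 2 := by
  induction m with
  | zero => simp
  | succ m ih =>
    rw [Finset.sum_range_succ, ih, Nat.add_sub_cancel]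
    push_cast
    ring

theorem tight_example_modified_min_subsidy {n : ℕ} (hn : 2 ≤ n)
    (v : Fin n → Finset (Fin n × Fin (n + 1)) → ℝ)
    (hv : ∀ (i : Fin n) (X : Finset (Fin n × Fin (n + 1))),
      v i X = ∑ e ∈ X,
        (if e.1 = i then (n : ℝ) / (n + 1)
         else if (e.1 : ℕ) + 1 = (i : ℕ) then 1 else 0))
    (A : Fin n → Finset (Fin n × Fin (n + 1)))
    (hA : ∀ i, A i = Finset.univ.filter (fun e => e.1 = i))
    -- `e* = e_{1,1}` and `A' = (A_1 \ {e*}, A_2, ..., A_{n-1}, A_n ∪ {e*})`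
    (estar : Fin n × Fin (n + 1)) (hestar : estar = (⟨0, by omega⟩, ⟨0, by omega⟩))
    (A' : Fin n → Finset (Fin n × Fin (n + 1)))
    (hA' : ∀ i : Fin n, A' i =
      if i = ⟨0, by omega⟩ then (A ⟨0, by omega⟩).erase estar
      else if i = ⟨n - 1, by omega⟩ then insert estar (A ⟨n - 1, by omega⟩)
      else A i)
    (w' : Fin n → Fin n → ℝ) (hw' : ∀ i j, w' i j = v i (A' j))
    -- the claimed minimum subsidy vector `(0, 0, 1, 2, ..., n-2)`
    (p' : Fin n → ℝ) (hp' : ∀ i, p' i = (((i : ℕ) - 1 : ℕ) : ℝ)) :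
    (∃ σ : Equiv.Perm (Fin n), maxWeightPerm w' σ ∧ minSubsidyVec w' σ p') ∧
    Finset.univ.sup' ⟨⟨0, by omega⟩, Finset.mem_univ _⟩ p' = (n : ℝ) - 2 ∧
    ∑ i, p' i = ((n : ℝ) - 1) * ((n : ℝ) - 2) / 2 := by
  have hweight : w' = fun i j : Fin n => modifiedWeight n i j := by
    funext i j
    have hn1 : (n : ℝ) + 1 ≠ 0 := by positivity
    have hbase (j : Fin n) : ∑ e ∈ A j,
        (if e.1 = i then (n : ℝ) / (n + 1)
         else if (e.1 : ℕ) + 1 = (i : ℕ) then 1 else 0) =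
        if (j : ℕ) = i then (n : ℝ) else if (j : ℕ) + 1 = i then (n : ℝ) + 1 else 0 := by
      rw [hA, sum_filter_fst_eq (fun k : Fin n => if k = i then (n : ℝ) / (n + 1)
         else if (k : ℕ) + 1 = (i : ℕ) then 1 else 0)]
      simp only [Fin.ext_iff]
      split_ifs <;> simp [mul_div_cancel₀, hn1]
    rw [hw', hv, hA', modifiedWeight]
    by_cases hj0 : j = ⟨0, by omega⟩
    · subst hj0
      rw [if_pos rfl, Finset.sum_erase_eq_sub (by simp [hA, hestar]), hbase, hestar]
      simp [Fin.ext_iff, @eq_comm _ 0, @eq_comm _ 1, sub_eq_add_neg]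
      split_ifs <;> simp
    · by_cases hj1 : j = ⟨n - 1, by omega⟩
      · subst hj1
        have hlast : n - 1 ≠ 0 := by omega
        rw [if_neg hj0, if_pos rfl, Finset.sum_insert
          (by simp [hA, hestar, Fin.ext_iff, hlast.symm]), hbase, hestar]
        simp [Fin.ext_iff, @eq_comm ℕ 0 i, @eq_comm ℕ 1 i, hlast, add_comm]
      · have hj0' : (j : ℕ) ≠ 0 := fun h => hj0 (Fin.ext h)
        have hj1' : (j : ℕ) ≠ n - 1 := fun h => hj1 (Fin.ext h)
        rw [if_neg hj0, if_neg hj1, hbase]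
        simp [hj0', hj1']
  obtain rfl : p' = fun i : Fin n => (((i : ℕ) - 1 : ℕ) : ℝ) := funext hp'
  subst hweight
  refine ⟨⟨1, maxWeightPerm_of_inP (inP_modifiedWeight hn), inP_modifiedWeight hn,
    fun p hp i => le_of_inP_modifiedWeight hp i i.2⟩, ?_, ?_⟩
  · apply le_antisymm
    · refine Finset.sup'_le _ _ fun i _ => ?_
      have hi : (i : ℕ) - 1 + 2 ≤ n := by omega
      have hi' : (((i : ℕ) - 1 : ℕ) : ℝ) + 2 ≤ n := by exact_mod_cast hi
      linarith
    · refine le_trans (le_of_eq ?_) (Finset.le_sup' _ (Finset.mem_univ ⟨n - 1, by omega⟩))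
      simp only [Nat.sub_sub]
      rw [Nat.cast_sub hn, Nat.cast_ofNat]
  · rw [Fin.sum_univ_eq_sum_range (fun i => ((i - 1 : ℕ) : ℝ)) n]
    obtain ⟨m, rfl⟩ : ∃ m, n = m + 1 := ⟨n - 1, by omega⟩
    rw [sum_range_sub_one]
    push_cast
    ring
end
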